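/- Let G = (V,E) be a directed graph with |V| = n ≥ 2 and let ℓ be an integer with 1 ≤ ℓ ≤ n. Then there exists a set H ⊆ V with |H| ≤ ⌊(2n/ℓ)·ln n⌋ + 1 such that for all s,t ∈ V with δ_G(s,t) < ∞, either δ_G(s,t) < ℓ, or there exists v ∈ H with δ_G(s,v) ≤ ℓ and δ_G(v,t) < ∞. -/

import Mathlib

open scoped Classical

namespace Paper

variable {V : Type*}

/-- `p` (restricted to indices `0,…,k`) is a walk of length `k` w.r.t. the edge relation `E`. -/
def IsWalk (E : V → V → Prop) (k : ℕ) (p : ℕ → V) : Prop :=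
  ∀ i, i < k → E (p i) (p (i + 1))

/-- The distance `δ_G(s,t)`. -/
noncomputable def gdist (E : V → V → Prop) (s t : V) : ℕ∞ :=
  ⨅ (k : ℕ) (_ : ∃ p : ℕ → V, p 0 = s ∧ p k = t ∧ IsWalk E k p), (k : ℕ∞)

theorem gdist_le_of_walk (E : V → V → Prop) (k : ℕ) (p : ℕ → V) (h : IsWalk E k p) :
    gdist E (p 0) (p k) ≤ (k : ℕ∞) :=
  iInf₂_le k ⟨p, rfl, rfl, h⟩

theorem exists_walk_of_gdist (E : V → V → Prop) (s t : V) (h : gdist E s t ≠ ⊤) :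
    ∃ k : ℕ, ∃ p : ℕ → V, p 0 = s ∧ p k = t ∧ IsWalk E k p ∧ gdist E s t = (k : ℕ∞) := by
  have hex : ∃ k : ℕ, ∃ p : ℕ → V, p 0 = s ∧ p k = t ∧ IsWalk E k p := by
    by_contra hcon
    apply h
    unfold gdist
    refine iInf_eq_top.2 fun k => iInf_eq_top.2 fun hk => ?_
    exact absurd ⟨k, hk⟩ hcon
  obtain ⟨p, h0, hk, hw⟩ := Nat.find_spec hex
  refine ⟨Nat.find hex, p, h0, hk, hw, le_antisymm (iInf₂_le _ ⟨p, h0, hk, hw⟩) ?_⟩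
  refine le_iInf₂ fun m hm => ?_
  exact_mod_cast Nat.find_min' hex hm

theorem shortest_inj (E : V → V → Prop) (k : ℕ) (p : ℕ → V) (hw : IsWalk E k p)
    (hd : gdist E (p 0) (p k) = (k : ℕ∞)) (i j : ℕ) (hij : i < j) (hj : j ≤ k) :
    p i ≠ p j := by
  intro heq
  let q : ℕ → V := fun m => if m ≤ i then p m else p (m + (j - i))
  have hq : IsWalk E (k - (j - i)) q := by
    intro m hm
    rcases lt_trichotomy m i with h | h | h
    · have h1 : m ≤ i := h.le
      have h2 : m + 1 ≤ i := h
      simp only [q, h1, h2, if_true]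
      exact hw m (by omega)
    · subst h
      have h2 : ¬ (m + 1 ≤ m) := by omega
      simp only [q, le_refl, h2, if_true, if_false]
      rw [heq, show m + 1 + (j - m) = j + 1 by omega]
      exact hw j (by omega)
    · have h1 : ¬ (m ≤ i) := by omega
      have h2 : ¬ (m + 1 ≤ i) := by omega
      simp only [q, h1, h2, if_false]
      rw [show m + 1 + (j - i) = m + (j - i) + 1 by omega]
      exact hw _ (by omega)
  have h0 : q 0 = p 0 := by simp [q]
  have hk : q (k - (j - i)) = p k := by
    simp only [q]
    split_ifs with h
    · have : j = k := by omega
      subst this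
      rw [show j - (j - i) = i by omega, heq]
    · congr 1
      omega
  have := gdist_le_of_walk E _ q hq
  rw [h0, hk, hd] at this
  have h3 : k ≤ k - (j - i) := by exact_mod_cast this
  omega

theorem greedy_hit {ι : Type*} [Fintype V] (U : Finset ι) (S : ι → Finset V) (ℓ : ℕ)
    (hl : ℓ ≤ Fintype.card V) (hpos : 0 < Fintype.card V) (hS : ∀ u ∈ U, ℓ ≤ (S u).card) (k : ℕ) :
    ∃ H : Finset V, H.card ≤ k ∧ ((U.filter (fun u => Disjoint (S u) H)).card : ℝ)
      ≤ U.card * (1 - (ℓ : ℝ) / Fintype.card V) ^ k := by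
  have hnpos : (0 : ℝ) < Fintype.card V := by exact_mod_cast hpos
  have hr : (0 : ℝ) ≤ 1 - (ℓ : ℝ) / Fintype.card V := by
    rw [sub_nonneg, div_le_one hnpos]
    exact_mod_cast hl
  induction k with
  | zero => exact ⟨∅, by simp, by simp⟩
  | succ k ih =>
    obtain ⟨H, hH, hc⟩ := ih
    set W := U.filter (fun u => Disjoint (S u) H) with hW
    have hdc : ∑ v : V, (W.filter (fun u => v ∈ S u)).card = ∑ u ∈ W, (S u).card := by
      simp only [Finset.card_filter]
      rw [Finset.sum_comm]
      refine Finset.sum_congr rfl fun u _ => ?_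
      rw [← Finset.card_filter]
      congr 1
      ext v
      simp
    have hge : W.card * ℓ ≤ ∑ v : V, (W.filter (fun u => v ∈ S u)).card := by
      rw [hdc, ← smul_eq_mul]
      exact Finset.card_nsmul_le_sum _ _ _ fun u hu => hS u (Finset.mem_filter.1 hu).1
    have hv : ∃ v : V, W.card * ℓ ≤ Fintype.card V * (W.filter (fun u => v ∈ S u)).card := by
      by_contra! hcon
      have hne : (Finset.univ : Finset V).Nonempty := by
        rw [← Finset.card_pos]; simpa using hpos
      have h1 := Finset.sum_lt_sum_of_nonempty hne (fun v _ => hcon v)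
      rw [← Finset.mul_sum, Finset.sum_const, Finset.card_univ, smul_eq_mul] at h1
      exact absurd (Nat.mul_le_mul_left (Fintype.card V) hge) (not_le.2 h1)
    obtain ⟨v, hv⟩ := hv
    refine ⟨insert v H, (Finset.card_insert_le _ _).trans (by omega), ?_⟩
    have hsub : U.filter (fun u => Disjoint (S u) (insert v H)) =
        W.filter (fun u => ¬ v ∈ S u) := by
      ext u
      simp only [hW, Finset.mem_filter, Finset.disjoint_insert_right]
      tauto
    have hsum := Finset.card_filter_add_card_filter_not (s := W) (fun u => v ∈ S u)
    rw [hsub]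
    have hsum' : ((W.filter (fun u => v ∈ S u)).card : ℝ)
      + ((W.filter (fun u => ¬ v ∈ S u)).card : ℝ) = W.card := by exact_mod_cast hsum
    have hv' : (W.card : ℝ) * ℓ / Fintype.card V ≤ ((W.filter (fun u => v ∈ S u)).card : ℝ) := by
      rw [div_le_iff₀ hnpos, mul_comm _ (Fintype.card V : ℝ)]
      exact_mod_cast hv
    calc ((W.filter (fun u => ¬ v ∈ S u)).card : ℝ)
        ≤ W.card * (1 - (ℓ : ℝ) / Fintype.card V) := by
          rw [mul_sub, mul_one, ← mul_div_assoc]; linarith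
      _ ≤ (U.card * (1 - (ℓ : ℝ) / Fintype.card V) ^ k) * (1 - (ℓ : ℝ) / Fintype.card V) :=
          mul_le_mul_of_nonneg_right hc hr
      _ = _ := by ring

/-- **Lemma 7.1 (existence content): a weak hitting set for reachability.** For any digraph
on `n ≥ 2` vertices and any `1 ≤ ℓ ≤ n` there is `H ⊆ V` with
`|H| ≤ ⌊(2n/ℓ)·ln n⌋ + 1` such that for all `s,t` with `δ_G(s,t) < ∞`, either
`δ_G(s,t) < ℓ` or some `v ∈ H` satisfies `δ_G(s,v) ≤ ℓ` and `δ_G(v,t) < ∞`. -/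
theorem weak_hitting_set {V : Type*} [Fintype V]
    (E : V → V → Prop) (n ℓ : ℕ)
    (hn : Fintype.card V = n) (hn2 : 2 ≤ n) (hl1 : 1 ≤ ℓ) (hln : ℓ ≤ n) :
    ∃ H : Finset V,
      H.card ≤ ⌊2 * (n : ℝ) / (ℓ : ℝ) * Real.log (n : ℝ)⌋₊ + 1 ∧
      ∀ s t : V, gdist E s t ≠ ⊤ →
        gdist E s t < (ℓ : ℕ∞) ∨
        ∃ v ∈ H, gdist E s v ≤ (ℓ : ℕ∞) ∧ gdist E v t ≠ ⊤ := by
  classical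
  subst hn
  set n := Fintype.card V with hn
  let S : V × V → Finset V := fun u =>
    Finset.univ.filter (fun v => gdist E u.1 v ≤ (ℓ : ℕ∞) ∧ gdist E v u.2 ≠ ⊤)
  let U : Finset (V × V) := Finset.univ.filter
    (fun u => gdist E u.1 u.2 ≠ ⊤ ∧ (ℓ : ℕ∞) ≤ gdist E u.1 u.2)
  have hS : ∀ u ∈ U, ℓ ≤ (S u).card := by
    rintro ⟨s, t⟩ hu
    simp only [U, Finset.mem_filter, Finset.mem_univ, true_and] at hu
    obtain ⟨k, p, h0, hk, hw, hd⟩ := exists_walk_of_gdist E s t hu.1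
    have hlk : ℓ ≤ k := by
      have := hu.2
      rw [hd] at this
      exact_mod_cast this
    rw [← h0, ← hk] at hd
    have hcard : ((Finset.range ℓ).image p).card = ℓ := by
      rw [Finset.card_image_of_injOn, Finset.card_range]
      intro i hi j hj hij
      simp only [Finset.coe_range, Set.mem_Iio] at hi hj
      by_contra hne
      rcases lt_or_gt_of_ne hne with h | h
      · exact shortest_inj E k p hw hd i j h (by omega) hij
      · exact shortest_inj E k p hw hd j i h (by omega) hij.symm
    rw [← hcard]
    apply Finset.card_le_card
    intro v hv
    obtain ⟨i, hi, rfl⟩ := Finset.mem_image.1 hv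
    have hi := Finset.mem_range.1 hi
    simp only [S, Finset.mem_filter, Finset.mem_univ, true_and]
    rw [← h0, ← hk]
    constructor
    · refine (gdist_le_of_walk E i p fun m hm => hw m (by omega)).trans ?_
      exact_mod_cast hi.le
    · have := gdist_le_of_walk E (k - i) (fun m => p (i + m))
        (fun m hm => hw (i + m) (by omega))
      simp only [add_zero] at this
      rw [show i + (k - i) = k by omega] at this
      exact ne_top_of_le_ne_top (ENat.coe_ne_top _) this
  obtain ⟨H, hH, hc⟩ := greedy_hit U S ℓ hln (by omega) hS
    (⌊2 * (n : ℝ) / (ℓ : ℝ) * Real.log (n : ℝ)⌋₊ + 1)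
  refine ⟨H, hH, ?_⟩
  rw [← hn] at hc
  set k := ⌊2 * (n : ℝ) / (ℓ : ℝ) * Real.log (n : ℝ)⌋₊ + 1 with hkdef
  have hnpos : (0 : ℝ) < n := by exact_mod_cast (by omega : 0 < n)
  have hlpos : (0 : ℝ) < ℓ := by exact_mod_cast hl1
  have hklt : 2 * (n : ℝ) / (ℓ : ℝ) * Real.log (n : ℝ) < k := by
    rw [hkdef]
    exact_mod_cast Nat.lt_floor_add_one _
  have hUc : (U.card : ℝ) ≤ (n : ℝ) ^ 2 := by
    have : U.card ≤ n * n := by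
      refine (Finset.card_le_univ U).trans ?_
      rw [Fintype.card_prod]
    rw [sq]
    exact_mod_cast this
  have hpow : (1 - (ℓ : ℝ) / n) ^ k ≤ Real.exp (-(k * ((ℓ : ℝ) / n))) := by
    have h1 : 1 - (ℓ : ℝ) / n ≤ Real.exp (-((ℓ : ℝ) / n)) := Real.one_sub_le_exp_neg _
    have h2 : 0 ≤ 1 - (ℓ : ℝ) / n := by
      rw [sub_nonneg, div_le_one hnpos]
      exact_mod_cast hln
    refine (pow_le_pow_left₀ h2 h1 k).trans_eq ?_
    rw [← Real.exp_nat_mul]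
    congr 1
    ring
  have hexp : Real.exp (-(k * ((ℓ : ℝ) / n))) < ((n : ℝ) ^ 2)⁻¹ := by
    rw [← Real.exp_log (pow_pos hnpos 2), ← Real.exp_neg, Real.exp_lt_exp, neg_lt_neg_iff,
      Real.log_pow]
    have h3 := mul_lt_mul_of_pos_right hklt (div_pos hlpos hnpos)
    have h4 : 2 * (n : ℝ) / (ℓ : ℝ) * Real.log (n : ℝ) * ((ℓ : ℝ) / n) = 2 * Real.log n := by
      field_simp
    rw [h4] at h3
    exact_mod_cast h3
  have hlt : ((U.filter (fun u => Disjoint (S u) H)).card : ℝ) < 1 := by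
    calc _ ≤ U.card * (1 - (ℓ : ℝ) / n) ^ k := hc
      _ ≤ U.card * Real.exp (-(k * ((ℓ : ℝ) / n))) := by gcongr
      _ ≤ (n : ℝ) ^ 2 * Real.exp (-(k * ((ℓ : ℝ) / n))) := by gcongr
      _ < (n : ℝ) ^ 2 * ((n : ℝ) ^ 2)⁻¹ := by gcongr
      _ = 1 := mul_inv_cancel₀ (by positivity)
  have hzero : (U.filter (fun u => Disjoint (S u) H)).card = 0 := by
    have : (U.filter (fun u => Disjoint (S u) H)).card < 1 := by exact_mod_cast hlt
    omega
  intro s t hst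
  by_cases hd : gdist E s t < (ℓ : ℕ∞)
  · exact Or.inl hd
  right
  have hmem : (s, t) ∈ U := by
    simp only [U, Finset.mem_filter, Finset.mem_univ, true_and]
    exact ⟨hst, not_lt.1 hd⟩
  have hnd : ¬ Disjoint (S (s, t)) H := by
    intro hdis
    have := Finset.card_eq_zero.1 hzero
    exact Finset.notMem_empty (s, t) (this ▸ Finset.mem_filter.2 ⟨hmem, hdis⟩)
  obtain ⟨v, hv1, hv2⟩ := Finset.not_disjoint_iff.1 hnd
  simp only [S, Finset.mem_filter, Finset.mem_univ, true_and] at hv1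
  exact ⟨v, hv2, hv1⟩

end Paper
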